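/- Let P be an admissible polytope all of whose vertices lie in v+M for some v ∈ Λ. Then Q(P) ∩ (v+M) = (P ∩ C⁺ ∩ (v+M)) + {Σᵢ nᵢ(−αᵢ) : nᵢ ∈ ℤ, nᵢ ≥ 0}, where + denotes Minkowski sum of subsets of V. -/

import Mathlib

open scoped RealInnerProductSpace Pointwise

/-- The orthogonal reflection `s_α` in the hyperplane orthogonal to `α`:
`s_α (x) = x − ⟨x, α^∨⟩ α` where `α^∨ = 2α/⟨α,α⟩`. -/
noncomputable def reflVec {V : Type*} [NormedAddCommGroup V] [InnerProductSpace ℝ V]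
    (α x : V) : V :=
  x - (2 * ⟪x, α⟫ / ⟪α, α⟫) • α

/-- A reduced crystallographic root system `Φ` spanning `V`, together with a fixed base
`α₁, …, α_l` of simple roots. -/
structure RootSystemWithBase (V : Type*) [NormedAddCommGroup V] [InnerProductSpace ℝ V]
    [FiniteDimensional ℝ V] (l : ℕ) where
  Φ : Set V
  finite : Φ.Finite
  spans : Submodule.span ℝ Φ = ⊤
  nz : ∀ α ∈ Φ, α ≠ 0
  reflMem : ∀ α ∈ Φ, ∀ β ∈ Φ, reflVec α β ∈ Φ
  cryst : ∀ α ∈ Φ, ∀ β ∈ Φ, ∃ n : ℤ, (n : ℝ) = 2 * ⟪β, α⟫ / ⟪α, α⟫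
  reduced : ∀ α ∈ Φ, ∀ t : ℝ, t • α ∈ Φ → t = 1 ∨ t = -1
  simple : Fin l → V
  simpleMem : ∀ i, simple i ∈ Φ
  indep : LinearIndependent ℝ simple
  base : ∀ β ∈ Φ, (∃ c : Fin l → ℝ, (∀ i, 0 ≤ c i) ∧ β = ∑ i, c i • simple i) ∨
      (∃ c : Fin l → ℝ, (∀ i, c i ≤ 0) ∧ β = ∑ i, c i • simple i)

namespace RootSystemWithBase

variable {V : Type*} [NormedAddCommGroup V] [InnerProductSpace ℝ V] [FiniteDimensional ℝ V]
variable {l : ℕ} (R : RootSystemWithBase V l)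

/-- The root lattice `M`, the ℤ-span of the roots. -/
def rootLattice : Submodule ℤ V := Submodule.span ℤ R.Φ

/-- The weight lattice `Λ = {x ∈ V : ⟨x, α^∨⟩ ∈ ℤ for all α ∈ Φ}`. -/
def weightLattice : Set V :=
  {x | ∀ α ∈ R.Φ, ∃ n : ℤ, (n : ℝ) = 2 * ⟪x, α⟫ / ⟪α, α⟫}

/-- The closed dominant chamber `C⁺`. -/
def domChamber : Set V := {x | ∀ i, 0 ≤ ⟪x, R.simple i⟫}

/-- The wall `H_j = {x : ⟨x, α_j⟩ = 0}`. -/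
def wall (j : Fin l) : Set V := {x | ⟪x, R.simple j⟫ = 0}

/-- Invariance under the Weyl group `W` (equivalently, invariance under each of the
generating reflections `s_α`, `α ∈ Φ`). -/
def WInvariant (P : Set V) : Prop := ∀ α ∈ R.Φ, ∀ x ∈ P, reflVec α x ∈ P

/-- `Q(P) = {m : ⟨m,u⟩ ≥ min_{p∈P} ⟨p,u⟩ for every u with ⟨α_i,u⟩ ≤ 0 for all i}`;
since the minimum over the (compact) polytope `P` is attained, `⟨m,u⟩ ≥ min_{p∈P}⟨p,u⟩`
is expressed as `∃ p ∈ P, ⟨p,u⟩ ≤ ⟨m,u⟩`. -/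
def Q (P : Set V) : Set V :=
  {m | ∀ u : V, (∀ i, ⟪R.simple i, u⟫ ≤ 0) → ∃ p ∈ P, ⟪p, u⟫ ≤ ⟪m, u⟫}

/-- An admissible polytope: a `W`-invariant polytope all of whose vertices lie in the
weight lattice and none of whose vertices lies on a wall. -/
def IsAdmissible (P : Set V) : Prop :=
  (∃ S : Set V, S.Finite ∧ S.Nonempty ∧ P = convexHull ℝ S) ∧
  R.WInvariant P ∧
  (∀ v ∈ P.extremePoints ℝ, v ∈ R.weightLattice) ∧
  ∀ j : Fin l, ∀ v ∈ P.extremePoints ℝ, v ∉ R.wall j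

end RootSystemWithBase

section Reflection

variable {V : Type*} [NormedAddCommGroup V] [InnerProductSpace ℝ V]

/-- The reflection `reflVec α` as a linear map. -/
noncomputable def reflLin (α : V) : V →ₗ[ℝ] V :=
  LinearMap.id - (2 / ⟪α, α⟫) • ((innerₗ V α).smulRight α)

lemma reflLin_apply (α x : V) : reflLin α x = reflVec α x := by
  simp only [reflLin, reflVec, LinearMap.sub_apply, LinearMap.id_apply, LinearMap.smul_apply,
    LinearMap.smulRight_apply, innerₗ_apply_apply, smul_smul, real_inner_comm]
  congr 2
  ring

lemma inner_reflVec_left (α x y : V) :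
    ⟪reflVec α x, y⟫ = ⟪x, y⟫ - 2 * ⟪x, α⟫ / ⟪α, α⟫ * ⟪α, y⟫ := by
  simp only [reflVec, inner_sub_left, real_inner_smul_left]

lemma inner_reflVec_comm (α x y : V) : ⟪reflVec α x, y⟫ = ⟪x, reflVec α y⟫ := by
  simp only [reflVec, inner_sub_left, inner_sub_right, real_inner_smul_left,
    real_inner_smul_right, real_inner_comm α]
  ring

lemma inner_reflVec_self {α : V} (hα : α ≠ 0) (x : V) : ⟪reflVec α x, α⟫ = -⟪x, α⟫ := by
  have h : ⟪α, α⟫ ≠ 0 := inner_self_ne_zero.mpr hα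
  rw [inner_reflVec_left]
  field_simp
  ring

/-- A linear functional that is at most `c` somewhere on a compact set is at most `c` at
some extreme point of that set. -/
lemma IsCompact.exists_extremePoint_inner_le {P : Set V} (hP : IsCompact P) {q : V}
    (hq : q ∈ P) (u : V) : ∃ e ∈ P.extremePoints ℝ, ⟪e, u⟫ ≤ ⟪q, u⟫ := by
  set f : StrongDual ℝ V := -innerSL ℝ u with hf
  have hexp : IsExposed ℝ P (f.toExposed P) := ContinuousLinearMap.toExposed.isExposed
  obtain ⟨z, hz, hzmax⟩ := hP.exists_isMaxOn ⟨q, hq⟩ f.continuous.continuousOn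
  have hne : (f.toExposed P).Nonempty := ⟨z, hz, fun y hy => hzmax hy⟩
  obtain ⟨e, he⟩ := (hexp.isCompact hP).extremePoints_nonempty hne
  refine ⟨e, hexp.isExtreme.extremePoints_subset_extremePoints he, ?_⟩
  have := (extremePoints_subset he).2 q hq
  simp only [hf, neg_apply, innerSL_apply_apply, neg_le_neg_iff] at this
  rwa [real_inner_comm, real_inner_comm u q]

end Reflection

namespace RootSystemWithBase

variable {V : Type*} [NormedAddCommGroup V] [InnerProductSpace ℝ V] [FiniteDimensional ℝ V]
variable {l : ℕ} (R : RootSystemWithBase V l)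

lemma simple_ne_zero (i : Fin l) : R.simple i ≠ 0 := R.nz _ (R.simpleMem i)

lemma inner_simple_self_pos (i : Fin l) : 0 < ⟪R.simple i, R.simple i⟫ :=
  real_inner_self_pos.mpr (R.simple_ne_zero i)

lemma span_range_simple : Submodule.span ℝ (Set.range R.simple) = ⊤ := by
  rw [eq_top_iff, ← R.spans, Submodule.span_le]
  intro β hβ
  obtain ⟨c, -, rfl⟩ | ⟨c, -, rfl⟩ := R.base β hβ <;>
  exact Submodule.sum_mem _ fun i _ =>
    Submodule.smul_mem _ _ (Submodule.subset_span ⟨i, rfl⟩)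

/-- The simple roots as a basis of `V`. -/
noncomputable def simpleBasis : Module.Basis (Fin l) ℝ V :=
  Module.Basis.mk R.indep R.span_range_simple.ge

@[simp]
lemma simpleBasis_apply (i : Fin l) : R.simpleBasis i = R.simple i := by
  simp [simpleBasis]

lemma exists_inner_simple_eq_one : ∃ ρ : V, ∀ i, ⟪ρ, R.simple i⟫ = 1 := by
  set f : V →ₗ[ℝ] ℝ := R.simpleBasis.constr ℝ fun _ => (1 : ℝ) with hf
  refine ⟨(InnerProductSpace.toDual ℝ V).symm (LinearMap.toContinuousLinearMap f), fun i => ?_⟩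
  rw [InnerProductSpace.toDual_symm_apply, LinearMap.coe_toContinuousLinearMap',
    ← R.simpleBasis_apply, hf, Module.Basis.constr_basis]

lemma inner_simple_nonpos {i j : Fin l} (h : i ≠ j) : ⟪R.simple i, R.simple j⟫ ≤ 0 := by
  have hjj := R.inner_simple_self_pos j
  set k : ℝ := 2 * ⟪R.simple i, R.simple j⟫ / ⟪R.simple j, R.simple j⟫ with hk
  have hmem := R.reflMem _ (R.simpleMem j) _ (R.simpleMem i)
  have key : ∀ c : Fin l → ℝ, reflVec (R.simple j) (R.simple i) = ∑ a, c a • R.simple a →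
      c i = 1 ∧ c j = -k := by
    intro c hc
    have hrepr : ∀ a, R.simpleBasis.repr (reflVec (R.simple j) (R.simple i)) a = c a := by
      intro a
      rw [hc]
      simp_rw [← R.simpleBasis_apply]
      rw [Module.Basis.repr_sum_self]
    have hsingle : ∀ a, R.simpleBasis.repr (R.simple a) = Finsupp.single a 1 := fun a => by
      rw [← R.simpleBasis_apply, Module.Basis.repr_self]
    simp only [reflVec, ← hk, map_sub, map_smul, hsingle] at hrepr
    exact ⟨by simpa [h] using (hrepr i).symm, by simpa [h] using (hrepr j).symm⟩
  have hk0 : k ≤ 0 := by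
    obtain ⟨c, hc, hs⟩ | ⟨c, hc, hs⟩ := R.base _ hmem
    · have := hc j
      rw [(key c hs).2] at this
      linarith
    · have := hc i
      rw [(key c hs).1] at this
      linarith
  by_contra! hpos
  have : 0 < k := by rw [hk]; positivity
  linarith

lemma finite_linearMap_mapsTo : {g : V →ₗ[ℝ] V | Set.MapsTo g R.Φ R.Φ}.Finite := by
  refine Set.Finite.of_finite_image (f := fun g i => g (R.simple i))
    ((Set.Finite.pi' fun _ : Fin l => R.finite).subset ?_) ?_
  · rintro _ ⟨g, hg, rfl⟩ i
    exact hg (R.simpleMem i)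
  · intro g _ g' _ h
    refine R.simpleBasis.ext fun i => ?_
    simpa using congrFun h i

lemma rootLattice_subset_weightLattice {x : V} (hx : x ∈ R.rootLattice) :
    x ∈ R.weightLattice := by
  intro α hα
  induction hx using Submodule.span_induction with
  | mem β hβ => exact R.cryst α hα β hβ
  | zero => exact ⟨0, by simp⟩
  | add x y _ _ hx hy =>
    obtain ⟨a, ha⟩ := hx
    obtain ⟨b, hb⟩ := hy
    exact ⟨a + b, by rw [Int.cast_add, ha, hb, inner_add_left]; ring⟩
  | smul n x _ hx =>
    obtain ⟨a, ha⟩ := hx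
    refine ⟨n * a, ?_⟩
    push_cast
    rw [ha, ← Int.cast_smul_eq_zsmul ℝ, real_inner_smul_left]
    ring

lemma add_mem_weightLattice {x y : V} (hx : x ∈ R.weightLattice) (hy : y ∈ R.weightLattice) :
    x + y ∈ R.weightLattice := by
  intro α hα
  obtain ⟨a, ha⟩ := hx α hα
  obtain ⟨b, hb⟩ := hy α hα
  exact ⟨a + b, by rw [Int.cast_add, ha, hb, inner_add_left]; ring⟩

lemma simple_mem_rootLattice (i : Fin l) : R.simple i ∈ R.rootLattice :=
  Submodule.subset_span (R.simpleMem i)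

variable {R} {P : Set V}

lemma IsAdmissible.isCompact (hP : R.IsAdmissible P) : IsCompact P := by
  obtain ⟨⟨S, hS, -, rfl⟩, -⟩ := hP
  exact hS.isCompact_convexHull ℝ

lemma IsAdmissible.convex (hP : R.IsAdmissible P) : Convex ℝ P := by
  obtain ⟨⟨S, -, -, rfl⟩, -⟩ := hP
  exact convex_convexHull ℝ S

/-- If `m` is dominant, the defining inequalities of `Q P` at `m` for antidominant `u` imply
those for all `u`. -/
lemma exists_inner_le_of_mem_Q (hW : R.WInvariant P) {m : V} (hm : m ∈ R.Q P)
    (hdom : m ∈ R.domChamber) (u : V) : ∃ p ∈ P, ⟪p, u⟫ ≤ ⟪m, u⟫ := by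
  obtain ⟨ρ, hρ⟩ := R.exists_inner_simple_eq_one
  by_contra hu
  set O : Set V := (fun g : V →ₗ[ℝ] V => g u) '' {g | Set.MapsTo g R.Φ R.Φ} with hO
  set B : Set V := {w ∈ O | ¬ ∃ p ∈ P, ⟪p, w⟫ ≤ ⟪m, w⟫} with hB
  have hfin : B.Finite := (R.finite_linearMap_mapsTo.image _).subset (Set.sep_subset _ _)
  have hne : B.Nonempty := ⟨u, ⟨LinearMap.id, Set.mapsTo_id _, rfl⟩, hu⟩
  obtain ⟨w, ⟨⟨g, hg, rfl⟩, hwbad⟩, hmin⟩ := Set.exists_min_image B (fun w => ⟪ρ, w⟫) hfin hne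
  dsimp only at hwbad hmin
  set w := g u with hw
  have hex : ∃ j, 0 < ⟪R.simple j, w⟫ := by
    by_contra! hanti
    exact hwbad (hm w hanti)
  obtain ⟨j, hj⟩ := hex
  have hjj := R.inner_simple_self_pos j
  have hrefl : reflVec (R.simple j) w ∈ B := by
    refine ⟨⟨reflLin (R.simple j) ∘ₗ g, fun β hβ => ?_, ?_⟩, ?_⟩
    · rw [LinearMap.comp_apply, reflLin_apply]
      exact R.reflMem _ (R.simpleMem j) _ (hg hβ)
    · exact reflLin_apply _ _
    · rintro ⟨p, hp, hle⟩
      refine hwbad ⟨_, hW _ (R.simpleMem j) p hp, ?_⟩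
      rw [inner_reflVec_comm]
      refine hle.trans ?_
      rw [← inner_reflVec_comm, inner_reflVec_left]
      have := hdom j
      have : 0 ≤ 2 * ⟪m, R.simple j⟫ / ⟪R.simple j, R.simple j⟫ * ⟪R.simple j, w⟫ := by
        positivity
      linarith
  have := hmin _ hrefl
  rw [← inner_reflVec_comm, inner_reflVec_left, hρ j] at this
  have : 0 < 2 * 1 / ⟪R.simple j, R.simple j⟫ * ⟪R.simple j, w⟫ := by positivity
  linarith

lemma IsAdmissible.mem_of_mem_Q (hP : R.IsAdmissible P) {m : V} (hm : m ∈ R.Q P)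
    (hdom : m ∈ R.domChamber) : m ∈ P := by
  by_contra hmP
  obtain ⟨f, c, hfm, hfP⟩ := geometric_hahn_banach_point_closed hP.convex
    hP.isCompact.isClosed hmP
  obtain ⟨p, hp, hle⟩ := exists_inner_le_of_mem_Q hP.2.1 hm hdom
    ((InnerProductSpace.toDual ℝ V).symm f)
  rw [real_inner_comm, InnerProductSpace.toDual_symm_apply, real_inner_comm,
    InnerProductSpace.toDual_symm_apply] at hle
  linarith [hfP p hp]

/-- Regularity of the vertices: a weight in `Q P` on the negative side of the wall of a simple
root stays in `Q P` after adding that root. -/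
lemma IsAdmissible.add_simple_mem_Q (hP : R.IsAdmissible P) {m : V} (hm : m ∈ R.Q P)
    (hmΛ : m ∈ R.weightLattice) {j : Fin l} (hj : ⟪m, R.simple j⟫ < 0) :
    m + R.simple j ∈ R.Q P := by
  intro u hu
  set α := R.simple j with hα
  have hαα : 0 < ⟪α, α⟫ := R.inner_simple_self_pos j
  set t : ℝ := -⟪α, u⟫ with ht
  have ht0 : 0 ≤ t := by have := hu j; linarith
  set u' : V := u + (t / ⟪α, α⟫) • α with hu'
  have hinner : ∀ x : V, ⟪x, u'⟫ = ⟪x, u⟫ + t / 2 * (2 * ⟪x, α⟫ / ⟪α, α⟫) := by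
    intro x
    rw [hu', inner_add_right, real_inner_smul_right]
    ring
  have hαu' : ⟪α, u'⟫ = 0 := by
    rw [hinner, ht]
    field_simp
    ring
  have hanti : ∀ i, ⟪R.simple i, u'⟫ ≤ 0 := by
    intro i
    by_cases hij : i = j
    · rw [hij, ← hα, hαu']
    · rw [hu', inner_add_right, real_inner_smul_right]
      have := mul_nonpos_of_nonneg_of_nonpos (div_nonneg ht0 hαα.le) (R.inner_simple_nonpos hij)
      linarith [hu i]
  obtain ⟨q, hq, hqle⟩ := hm u' hanti
  obtain ⟨e, he, hele⟩ := hP.isCompact.exists_extremePoint_inner_le hq u'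
  have hmval : 2 * ⟪m, α⟫ / ⟪α, α⟫ ≤ -1 := by
    obtain ⟨n, hn⟩ := hmΛ α (R.simpleMem j)
    have hneg : 2 * ⟪m, α⟫ / ⟪α, α⟫ < 0 := div_neg_of_neg_of_pos (by linarith) hαα
    rw [← hn] at hneg ⊢
    have : n < 0 := by exact_mod_cast hneg
    exact_mod_cast (by omega : n ≤ -1)
  obtain ⟨p, hp, hple, hpval⟩ :
      ∃ p ∈ P, ⟪p, u'⟫ = ⟪e, u'⟫ ∧ 1 ≤ 2 * ⟪p, α⟫ / ⟪α, α⟫ := by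
    obtain ⟨n, hn⟩ := hP.2.2.1 e he α (R.simpleMem j)
    have hn0 : n ≠ 0 := by
      rintro rfl
      refine hP.2.2.2 j e he (?_ : ⟪e, α⟫ = 0)
      rw [Int.cast_zero, eq_comm, div_eq_zero_iff] at hn
      rcases hn with h | h <;> linarith
    rcases lt_or_gt_of_ne hn0 with h | h
    · refine ⟨reflVec α e, hP.2.1 α (R.simpleMem j) e (extremePoints_subset he), ?_, ?_⟩
      · rw [inner_reflVec_left, hαu', mul_zero, sub_zero]
      · rw [inner_reflVec_self (R.simple_ne_zero j), mul_neg, neg_div, ← hn]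
        exact_mod_cast (by omega : 1 ≤ -n)
    · refine ⟨e, extremePoints_subset he, rfl, ?_⟩
      rw [← hn]
      exact_mod_cast (by omega : 1 ≤ n)
  refine ⟨p, hp, ?_⟩
  rw [inner_add_left]
  rw [← hple] at hele
  have hle := hele.trans hqle
  rw [hinner p, hinner m] at hle
  have h1 := mul_le_mul_of_nonneg_left hpval (by linarith : 0 ≤ t / 2)
  have h2 := mul_le_mul_of_nonneg_left hmval (by linarith : 0 ≤ t / 2)
  linarith

/-- Every weight in `Q P` is a dominant one minus a sum of simple roots. -/
lemma IsAdmissible.exists_dominant (hP : R.IsAdmissible P) {m : V} (hm : m ∈ R.Q P)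
    (hmΛ : m ∈ R.weightLattice) :
    ∃ p ∈ R.Q P ∩ R.domChamber, ∃ n : Fin l → ℤ, (∀ i, 0 ≤ n i) ∧
      m + ∑ i, (n i : ℝ) • R.simple i = p := by
  obtain ⟨ρ, hρ⟩ := R.exists_inner_simple_eq_one
  obtain ⟨b, hb⟩ := hP.isCompact.bddAbove_image
    (f := fun x => ⟪x, ρ⟫) (by fun_prop)
  have hbound : ∀ x ∈ R.Q P, ⟪x, ρ⟫ ≤ b := by
    intro x hx
    obtain ⟨p, hp, hle⟩ := hx (-ρ) fun i => by
      rw [inner_neg_right, real_inner_comm, hρ]; norm_num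
    rw [inner_neg_right, inner_neg_right, neg_le_neg_iff] at hle
    exact hle.trans (hb ⟨p, hp, rfl⟩)
  obtain ⟨N, hN⟩ := exists_nat_gt (b - ⟪m, ρ⟫)
  induction N generalizing m with
  | zero =>
    have := hbound m hm
    rw [Nat.cast_zero] at hN
    linarith
  | succ N ih =>
    by_cases hdom : m ∈ R.domChamber
    · exact ⟨m, ⟨hm, hdom⟩, 0, fun _ => le_rfl, by simp⟩
    · obtain ⟨j, hj⟩ : ∃ j, ⟪m, R.simple j⟫ < 0 := by
        simpa [domChamber] using hdom
      obtain ⟨p, hp, n, hn, rfl⟩ := ih (hP.add_simple_mem_Q hm hmΛ hj)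
        (R.add_mem_weightLattice hmΛ
          (R.rootLattice_subset_weightLattice (R.simple_mem_rootLattice j)))
        (by
          rw [inner_add_left, real_inner_comm ρ (R.simple j), hρ]
          push_cast at hN
          linarith)
      refine ⟨_, hp, n + Pi.single j 1, fun i => ?_, ?_⟩
      · have : (0 : Fin l → ℤ) ≤ Pi.single j 1 := Pi.single_nonneg.mpr zero_le_one
        exact add_nonneg (hn i) (this i)
      · have : ∑ i, ((Pi.single j (1 : ℤ) : Fin l → ℤ) i : ℝ) • R.simple i = R.simple j := by
          rw [Finset.sum_eq_single j (fun i _ hi => by simp [hi]) (by simp)]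
          simp
        simp only [Pi.add_apply, Int.cast_add, add_smul, Finset.sum_add_distrib, this]
        abel

variable (R) in
lemma sum_smul_simple_mem_rootLattice (n : Fin l → ℤ) :
    ∑ i, (n i : ℝ) • R.simple i ∈ R.rootLattice := by
  refine Submodule.sum_mem _ fun i _ => ?_
  rw [Int.cast_smul_eq_zsmul]
  exact Submodule.smul_mem _ _ (R.simple_mem_rootLattice i)

end RootSystemWithBase

/-- for an admissible polytope `P` with all vertices in `v + M` (`v ∈ Λ`),
`Q(P) ∩ (v+M) = (P ∩ C⁺ ∩ (v+M)) + {Σᵢ nᵢ(−αᵢ) : nᵢ ∈ ℤ, nᵢ ≥ 0}`. -/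
theorem stmt2 {V : Type*} [NormedAddCommGroup V] [InnerProductSpace ℝ V]
    [FiniteDimensional ℝ V] {l : ℕ} (R : RootSystemWithBase V l)
    (P : Set V) (hP : R.IsAdmissible P) (v : V) (hv : v ∈ R.weightLattice)
    (hvert : ∀ x ∈ P.extremePoints ℝ, x - v ∈ R.rootLattice) :
    R.Q P ∩ {x | x - v ∈ R.rootLattice} =
      (P ∩ R.domChamber ∩ {x | x - v ∈ R.rootLattice}) +
        {x : V | ∃ n : Fin l → ℤ, (∀ i, 0 ≤ n i) ∧ x = ∑ i, (n i : ℝ) • (-(R.simple i))} := by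
  simp only [smul_neg, Finset.sum_neg_distrib]
  ext m
  constructor
  · rintro ⟨hmQ, hmv⟩
    have hmΛ : m ∈ R.weightLattice := by
      simpa using R.add_mem_weightLattice (R.rootLattice_subset_weightLattice hmv) hv
    obtain ⟨p, ⟨hpQ, hpdom⟩, n, hn, rfl⟩ := hP.exists_dominant hmQ hmΛ
    refine Set.mem_add.mpr ⟨_, ⟨⟨hP.mem_of_mem_Q hpQ hpdom, hpdom⟩, ?_⟩, _, ⟨n, hn, rfl⟩, ?_⟩
    · rw [Set.mem_ofPred_eq, add_sub_right_comm]
      exact add_mem hmv (R.sum_smul_simple_mem_rootLattice n)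
    · abel
  · rintro ⟨p, ⟨⟨hpP, -⟩, hpv⟩, _, ⟨n, hn, rfl⟩, rfl⟩
    refine ⟨fun u hu => ⟨p, hpP, ?_⟩, ?_⟩
    · simp only [inner_add_left, inner_neg_left, sum_inner, real_inner_smul_left]
      have : ∑ i, (n i : ℝ) * ⟪R.simple i, u⟫ ≤ 0 := Finset.sum_nonpos fun i _ =>
        mul_nonpos_of_nonneg_of_nonpos (by exact_mod_cast hn i) (hu i)
      linarith
    · rw [Set.mem_ofPred_eq, add_sub_right_comm]
      exact add_mem hpv (neg_mem (R.sum_smul_simple_mem_rootLattice n))
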